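/- Let μ be a positive finite Borel measure on T̄ and λ : T̄ → [0,1] a Borel function, and let λμ denote the measure A ↦ ∫_A λ dμ. Define σ_μ : T → [0,∞) by σ_μ(x) = (I*μ(x))^{p'} π(x)^{1−p'}, and set I*σ_μ(x) = Σ_{y ∈ S(x)} σ_μ(y); define σ_{λμ} and I*σ_{λμ} analogously with λμ in place of μ. If I*σ_μ(x) ≤ I*μ(x) for every x ∈ T, then I*σ_{λμ}(x) ≤ p · I*(λμ)(x) for every x ∈ T. -/

import Mathlib

open MeasureTheory Set
open scoped ENNReal

/-- A countable rooted tree with at least one and at most `N` children at each vertex. -/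
structure PTTree where
  V : Type
  countableV : Countable V
  root : V
  parent : V → V
  parent_root : parent root = root
  reaches_root : ∀ x : V, ∃ n : ℕ, parent^[n] x = root
  N : ℕ
  one_le_N : 1 ≤ N
  child_exists : ∀ x : V, ∃ y : V, parent y = x ∧ y ≠ x
  child_finite : ∀ x : V, {y : V | parent y = x ∧ y ≠ x}.Finite
  child_card : ∀ x : V, {y : V | parent y = x ∧ y ≠ x}.ncard ≤ N

namespace PTTree

/-- The tree order: `x ≤ y` iff `x` is an iterated parent of `y` (or `x = y`). -/
def le (t : PTTree) (x y : t.V) : Prop := ∃ n : ℕ, t.parent^[n] y = x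

/-- The predecessor set `P(x) = {y | y ≤ x}`. -/
def P (t : PTTree) (x : t.V) : Set t.V := {y : t.V | t.le y x}

/-- The successor set `S(x) = {y | y ≥ x}`. -/
def S (t : PTTree) (x : t.V) : Set t.V := {y : t.V | t.le x y}

/-- The boundary `∂T`: half-infinite geodesics starting at the root. -/
def Bdry (t : PTTree) : Type :=
  { ξ : ℕ → t.V // ξ 0 = t.root ∧ ∀ n : ℕ, t.parent (ξ (n + 1)) = ξ n }

/-- `T̄ = T ⊔ ∂T`. -/
def Tbar (t : PTTree) : Type := t.V ⊕ t.Bdry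

/-- Inclusion of vertices in `T̄`. -/
def inV (t : PTTree) (x : t.V) : t.Tbar := Sum.inl x

/-- Inclusion of boundary points in `T̄`. -/
def inB (t : PTTree) (ξ : t.Bdry) : t.Tbar := Sum.inr ξ

/-- `S̄(x) ⊆ T̄`: the successors of `x` together with the boundary geodesics through `x`. -/
def Sbar (t : PTTree) (x : t.V) : Set t.Tbar :=
  {z : t.Tbar |
    Sum.elim (fun y : t.V => t.le x y) (fun ξ : t.Bdry => ∃ n : ℕ, ξ.1 n = x) z}

/-- The predecessor set `P(ζ) ⊆ T` of a point `ζ ∈ T̄`. -/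
def PT (t : PTTree) : t.Tbar → Set t.V :=
  Sum.elim (fun x : t.V => t.P x) (fun ξ : t.Bdry => Set.range ξ.1)

/-- The compact metrizable topology on `T̄`: vertices are isolated and the sets `S̄(x)` form a
neighbourhood basis along `∂T`. -/
def top (t : PTTree) : TopologicalSpace t.Tbar :=
  TopologicalSpace.generateFrom
    ((Set.range fun x : t.V => ({t.inV x} : Set t.Tbar)) ∪ Set.range t.Sbar)

/-- The Borel σ-algebra of `T̄`. -/
def borelT (t : PTTree) : MeasurableSpace t.Tbar := @borel t.Tbar t.top

/-- The Hardy operator `If(ζ) = Σ_{y ∈ P(ζ)} f(y)`. -/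
noncomputable def Ifun (t : PTTree) (f : t.V → ℝ≥0∞) (ζ : t.Tbar) : ℝ≥0∞ :=
  ∑' y : t.PT ζ, f y.1

/-- `I*μ(x) = μ(S̄(x))`. -/
noncomputable def Istar (t : PTTree) (μ : @Measure t.Tbar t.borelT) (x : t.V) : ℝ≥0∞ :=
  μ (t.Sbar x)

/-- `Σ_{x ∈ S(a)} (I*μ(x))^{p'} π(x)^{1-p'}`, with `p' = p/(p-1)`. -/
noncomputable def sigmaSum (t : PTTree) (π : t.V → ℝ) (p : ℝ)
    (μ : @Measure t.Tbar t.borelT) (a : t.V) : ℝ≥0∞ :=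
  ∑' x : t.S a, t.Istar μ x.1 ^ (p / (p - 1)) * ENNReal.ofReal (π x.1) ^ (1 - p / (p - 1))

/-- The Carleson/testing constant
`[μ] = sup_{a : I*μ(a) > 0} (Σ_{x ∈ S(a)} (I*μ(x))^{p'} π(x)^{1-p'} / I*μ(a))^{p-1}`. -/
noncomputable def CC (t : PTTree) (π : t.V → ℝ) (p : ℝ)
    (μ : @Measure t.Tbar t.borelT) : ℝ≥0∞ :=
  ⨆ (a : t.V) (_ : 0 < t.Istar μ a), (t.sigmaSum π p μ a / t.Istar μ a) ^ (p - 1)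

/-- The tree capacity `Cap(E) = inf { Σ_x φ(x)^p π(x) : Iφ ≥ 1 on E }`. -/
noncomputable def Cap (t : PTTree) (π : t.V → ℝ) (p : ℝ) (E : Set t.Tbar) : ℝ≥0∞ :=
  ⨅ (φ : t.V → ℝ≥0∞) (_ : ∀ ζ ∈ E, 1 ≤ t.Ifun φ ζ),
    ∑' x : t.V, φ x ^ p * ENNReal.ofReal (π x)

/-- The potential-theoretic distance from the root
`d_π(ζ) = Σ_{y ∈ P(ζ)} π(y)^{1-p'}`. -/
noncomputable def dpi (t : PTTree) (π : t.V → ℝ) (p : ℝ) (ζ : t.Tbar) : ℝ≥0∞ :=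
  ∑' y : t.PT ζ, ENNReal.ofReal (π y.1) ^ (1 - p / (p - 1))

/-- The tree maximal function `M_μ g(ζ) = sup_{β ∈ P(ζ), μ(S̄(β)) > 0} (∫_{S̄(β)} g dμ) / μ(S̄(β))`. -/
noncomputable def Mfun (t : PTTree) (μ : @Measure t.Tbar t.borelT)
    (g : t.Tbar → ℝ≥0∞) (ζ : t.Tbar) : ℝ≥0∞ :=
  ⨆ (β : t.V) (_ : β ∈ t.PT ζ) (_ : 0 < μ (t.Sbar β)),
    (∫⁻ z in t.Sbar β, g z ∂μ) / μ (t.Sbar β)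

/-- The tree maximal function of a measure,
`M_μ σ(ζ) = sup_{β ∈ P(ζ), μ(S̄(β)) > 0} σ(S̄(β)) / μ(S̄(β))`. -/
noncomputable def Mmeas (t : PTTree) (μ σ : @Measure t.Tbar t.borelT)
    (ζ : t.Tbar) : ℝ≥0∞ :=
  ⨆ (β : t.V) (_ : β ∈ t.PT ζ) (_ : 0 < μ (t.Sbar β)), σ (t.Sbar β) / μ (t.Sbar β)

end PTTree

theorem setLIntegral_Ioc_mul_rpow {q r : ℝ} (hq : 0 < q) (hr : 0 ≤ r) (c : ℝ) (hc : 0 ≤ c) :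
    ∫⁻ s in Ioc 0 r, ENNReal.ofReal (c * s ^ (q - 1)) = ENNReal.ofReal (c / q * r ^ q) := by
  have hint : IntervalIntegrable (fun s : ℝ => c * s ^ (q - 1)) volume 0 r :=
    (intervalIntegral.intervalIntegrable_rpow' (by linarith)).const_mul c
  rw [← ofReal_integral_eq_lintegral_ofReal
    ((intervalIntegrable_iff_integrableOn_Ioc_of_le hr).1 hint),
    ← intervalIntegral.integral_of_le hr, intervalIntegral.integral_const_mul,
    integral_rpow (Or.inl (by linarith))]
  · rw [sub_add_cancel, Real.zero_rpow hq.ne', sub_zero, mul_div_assoc', div_mul_eq_mul_div]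
  · filter_upwards [ae_restrict_mem measurableSet_Ioc] with s hs
    exact mul_nonneg hc (Real.rpow_nonneg hs.1.le _)

/-- The layer-cake formula for a power of a number in `[0, 1]`. -/
theorem ofReal_rpow_eq_setLIntegral {q r : ℝ} (hq : 0 < q) (hr : 0 ≤ r) (hr1 : r ≤ 1) :
    ENNReal.ofReal r ^ q =
      ∫⁻ s in Ioc (0 : ℝ) 1, (Iic r).indicator (fun s => ENNReal.ofReal (q * s ^ (q - 1))) s := by
  rw [lintegral_indicator measurableSet_Iic, Measure.restrict_restrict measurableSet_Iic,
    Set.inter_comm, Set.Ioc_inter_Iic, min_eq_right hr1,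
    setLIntegral_Ioc_mul_rpow hq hr q hq.le, div_self hq.ne', one_mul,
    ENNReal.ofReal_rpow_of_nonneg hr hq.le]

namespace PTTree

protected theorem le_refl (t : PTTree) (x : t.V) : t.le x x := ⟨0, rfl⟩

protected theorem le_trans (t : PTTree) {x y z : t.V} (hxy : t.le x y) (hyz : t.le y z) : t.le x z := by
  obtain ⟨n, rfl⟩ := hxy
  obtain ⟨m, rfl⟩ := hyz
  exact ⟨n + m, Function.iterate_add_apply _ _ _ _⟩

/-- Two predecessors of the same vertex are comparable. -/
theorem le_or_le_of_le (t : PTTree) {x y z : t.V} (hx : t.le x z) (hy : t.le y z) :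
    t.le x y ∨ t.le y x := by
  obtain ⟨n, rfl⟩ := hx
  obtain ⟨m, rfl⟩ := hy
  rcases Nat.le_total n m with h | h
  · exact Or.inr ⟨m - n, by rw [← Function.iterate_add_apply, Nat.sub_add_cancel h]⟩
  · exact Or.inl ⟨n - m, by rw [← Function.iterate_add_apply, Nat.sub_add_cancel h]⟩

theorem iterate_parent_root (t : PTTree) (n : ℕ) : t.parent^[n] t.root = t.root :=
  Function.iterate_fixed t.parent_root n

open Classical in
/-- The distance of a vertex from the root. -/
noncomputable def depth (t : PTTree) (x : t.V) : ℕ := Nat.find (t.reaches_root x)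

theorem iterate_depth (t : PTTree) (x : t.V) : t.parent^[t.depth x] x = t.root := by
  classical
  exact Nat.find_spec (t.reaches_root x)

theorem depth_le (t : PTTree) {x : t.V} {n : ℕ} (h : t.parent^[n] x = t.root) :
    t.depth x ≤ n := by
  classical
  exact Nat.find_min' (t.reaches_root x) h

theorem depth_lt (t : PTTree) {x y : t.V} (h : t.le x y) (hne : x ≠ y) :
    t.depth x < t.depth y := by
  obtain ⟨n, rfl⟩ := h
  have hn : n ≠ 0 := by
    rintro rfl
    exact hne rfl
  have hd : t.depth y ≠ 0 := by
    intro h0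
    have hy := t.iterate_depth y
    rw [h0] at hy
    obtain rfl : y = t.root := hy
    exact hne (t.iterate_parent_root n)
  have hle : t.depth (t.parent^[n] y) ≤ t.depth y - n := by
    apply t.depth_le
    rw [← Function.iterate_add_apply]
    have : t.depth y - n + n = (t.depth y - n + n - t.depth y) + t.depth y := by omega
    rw [this, Function.iterate_add_apply, t.iterate_depth, t.iterate_parent_root]
  omega

theorem bdry_iterate (t : PTTree) (ξ : t.Bdry) (k n : ℕ) :
    t.parent^[k] (ξ.1 n) = ξ.1 (n - k) := by
  induction k with
  | zero => rfl
  | succ k ih =>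
    rw [Function.iterate_succ_apply', ih]
    rcases Nat.eq_zero_or_pos (n - k) with h | h
    · rw [h, show n - (k + 1) = 0 by omega, ξ.2.1, t.parent_root]
    · rw [show n - k = (n - (k + 1)) + 1 by omega, ξ.2.2]

theorem Sbar_mono (t : PTTree) {x y : t.V} (h : t.le x y) : t.Sbar y ⊆ t.Sbar x := by
  rintro (z | ξ) hz
  · exact t.le_trans h hz
  · obtain ⟨n, hn⟩ := hz
    obtain ⟨k, rfl⟩ := h
    exact ⟨n - k, by rw [← t.bdry_iterate, hn]⟩

theorem le_or_le_of_mem_Sbar (t : PTTree) {x y : t.V} {z : t.Tbar} (hx : z ∈ t.Sbar x)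
    (hy : z ∈ t.Sbar y) : t.le x y ∨ t.le y x := by
  rcases z with z | ξ
  · exact t.le_or_le_of_le hx hy
  · obtain ⟨n, rfl⟩ := hx
    obtain ⟨m, rfl⟩ := hy
    rcases Nat.le_total n m with h | h
    · exact Or.inl ⟨m - n, by rw [t.bdry_iterate, Nat.sub_sub_self h]⟩
    · exact Or.inr ⟨n - m, by rw [t.bdry_iterate, Nat.sub_sub_self h]⟩

theorem measurableSet_Sbar (t : PTTree) (x : t.V) : @MeasurableSet t.Tbar t.borelT (t.Sbar x) :=
  MeasurableSpace.measurableSet_generateFrom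
    (TopologicalSpace.isOpen_generateFrom_of_mem (Or.inr ⟨x, rfl⟩))

/-- The minimal elements of a set of vertices. -/
def minimals (t : PTTree) (A : Set t.V) : Set t.V := {m ∈ A | ∀ y ∈ A, t.le y m → y = m}

theorem exists_minimals_le (t : PTTree) (A : Set t.V) {y : t.V} (hy : y ∈ A) :
    ∃ m ∈ t.minimals A, t.le m y := by
  induction hn : t.depth y using Nat.strong_induction_on generalizing y with
  | _ n ih =>
    by_cases hm : y ∈ t.minimals A
    · exact ⟨y, hm, t.le_refl y⟩
    · have : ∃ z ∈ A, t.le z y ∧ z ≠ y := by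
        by_contra! hc
        exact hm ⟨hy, hc⟩
      obtain ⟨z, hzA, hzy, hne⟩ := this
      obtain ⟨m, hm, hmz⟩ := ih _ (hn ▸ t.depth_lt hzy hne) hzA rfl
      exact ⟨m, hm, t.le_trans hmz hzy⟩

attribute [local instance] borelT

theorem tsum_minimals_Istar_le (t : PTTree) (ν : @Measure t.Tbar t.borelT) {A : Set t.V}
    {x : t.V} (hA : A ⊆ t.S x) : ∑' m : t.minimals A, t.Istar ν m.1 ≤ t.Istar ν x := by
  have := t.countableV
  unfold Istar
  have hdisj : Pairwise (Function.onFun Disjoint fun m : t.minimals A => t.Sbar m.1) := by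
    refine fun m m' hne => Set.disjoint_left.2 fun z hz hz' => ?_
    rcases t.le_or_le_of_mem_Sbar hz hz' with h | h
    · exact hne (Subtype.ext (m'.2.2 _ m.2.1 h))
    · exact hne (Subtype.ext (m.2.2 _ m'.2.1 h)).symm
  rw [← measure_iUnion hdisj fun m => t.measurableSet_Sbar m.1]
  exact measure_mono (Set.iUnion_subset fun m => t.Sbar_mono (hA m.2.1))

/-- The weak-type estimate: if `σ(S(a)) ≤ μ(S̄(a))` for all `a` and `s * μ(S̄(y)) ≤ ν(S̄(y))` on a set
`A` of successors of `x`, then `s * σ(A) ≤ ν(S̄(x))`. -/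
theorem mul_tsum_le_Istar (t : PTTree) (μ ν : @Measure t.Tbar t.borelT) (σ : t.V → ℝ≥0∞)
    (h : ∀ a, ∑' y : t.S a, σ y.1 ≤ t.Istar μ a) {A : Set t.V} {x : t.V} (hA : A ⊆ t.S x)
    {s : ℝ≥0∞} (hs : ∀ y ∈ A, s * t.Istar μ y ≤ t.Istar ν y) :
    s * ∑' y : A, σ y.1 ≤ t.Istar ν x := by
  have hsub : A ⊆ ⋃ m : t.minimals A, t.S m.1 := fun y hy => by
    obtain ⟨m, hm, hmy⟩ := t.exists_minimals_le A hy
    exact Set.mem_iUnion.2 ⟨⟨m, hm⟩, hmy⟩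
  calc s * ∑' y : A, σ y.1
      ≤ s * ∑' m : t.minimals A, t.Istar μ m.1 := by
        gcongr
        exact (ENNReal.tsum_mono_subtype σ hsub).trans
          ((ENNReal.tsum_iUnion_le_tsum σ _).trans (ENNReal.tsum_le_tsum fun m => h m.1))
    _ = ∑' m : t.minimals A, s * t.Istar μ m.1 := ENNReal.tsum_mul_left.symm
    _ ≤ ∑' m : t.minimals A, t.Istar ν m.1 := ENNReal.tsum_le_tsum fun m => hs _ m.2.1
    _ ≤ t.Istar ν x := t.tsum_minimals_Istar_le ν hA

theorem Istar_withDensity_le (t : PTTree) (μ : @Measure t.Tbar t.borelT)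
    {f : t.Tbar → ℝ≥0∞} (hf : ∀ ζ, f ζ ≤ 1) (y : t.V) :
    t.Istar (μ.withDensity f) y ≤ t.Istar μ y := by
  unfold Istar
  rw [withDensity_apply _ (t.measurableSet_Sbar y)]
  calc ∫⁻ ζ in t.Sbar y, f ζ ∂μ ≤ ∫⁻ _ in t.Sbar y, 1 ∂μ := lintegral_mono hf
    _ = μ (t.Sbar y) := by simp

/-- The testing condition for `μ` passes, up to the factor `p`, to every measure `ν` with
`I*ν ≤ I*μ`. -/
theorem sigmaSum_le_of_Istar_le (t : PTTree) (π : t.V → ℝ) {p : ℝ} (hp : 1 < p)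
    (μ ν : @Measure t.Tbar t.borelT) (hμ_top : ∀ y, t.Istar μ y ≠ ∞)
    (hνμ : ∀ y, t.Istar ν y ≤ t.Istar μ y)
    (h : ∀ y, t.sigmaSum π p μ y ≤ t.Istar μ y) (x : t.V) :
    t.sigmaSum π p ν x ≤ ENNReal.ofReal p * t.Istar ν x := by
  have := t.countableV
  set q := p / (p - 1) with hq_def
  have hp1 : 0 < p - 1 := sub_pos.2 hp
  have hq : 1 < q := (one_lt_div hp1).2 (by linarith)
  have hq0 : 0 < q := by linarith
  have hqp : q / (q - 1) = p := by
    rw [hq_def]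
    field_simp
    ring
  set r : t.V → ℝ := fun y => (t.Istar ν y / t.Istar μ y).toReal with hr
  have hdiv : ∀ y, t.Istar ν y / t.Istar μ y ≤ 1 := fun y =>
    ENNReal.div_le_of_le_mul (by simpa using hνμ y)
  have hr0 : ∀ y, 0 ≤ r y := fun y => ENNReal.toReal_nonneg
  have hr1 : ∀ y, r y ≤ 1 := fun y =>
    ENNReal.toReal_le_of_le_ofReal zero_le_one (by simpa using hdiv y)
  have hrν : ∀ y, ENNReal.ofReal (r y) * t.Istar μ y = t.Istar ν y := fun y => by
    rw [hr, ENNReal.ofReal_toReal ((hdiv y).trans_lt ENNReal.one_lt_top).ne]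
    exact ENNReal.div_mul_cancel' (fun h0 => le_antisymm (h0 ▸ hνμ y) zero_le)
      (fun h0 => (hμ_top y h0).elim)
  set σ : t.V → ℝ≥0∞ := fun y => t.Istar μ y ^ q * ENNReal.ofReal (π y) ^ (1 - q) with hσ
  have hmeas : ∀ y, Measurable
      ((Iic (r y)).indicator fun s : ℝ => ENNReal.ofReal (q * s ^ (q - 1))) := fun y =>
    Measurable.indicator (by fun_prop) measurableSet_Iic
  have hlevel : ∀ s ∈ Ioc (0 : ℝ) 1,
      ∑' y : t.S x, σ y.1 *
        (Iic (r y.1)).indicator (fun s : ℝ => ENNReal.ofReal (q * s ^ (q - 1))) s ≤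
      ENNReal.ofReal (q * s ^ (q - 1 - 1)) * t.Istar ν x := by
    intro s hs
    have hweak := t.mul_tsum_le_Istar μ ν σ h (A := {y | y ∈ t.S x ∧ s ≤ r y}) (x := x)
      (fun y hy => hy.1) (s := ENNReal.ofReal s) (fun y hy => by
        rw [← hrν y]
        gcongr
        exact hy.2)
    have hpow : ENNReal.ofReal (q * s ^ (q - 1)) =
        ENNReal.ofReal (q * s ^ (q - 1 - 1)) * ENNReal.ofReal s := by
      rw [← ENNReal.ofReal_mul (by have := hs.1; positivity), Real.rpow_sub_one hs.1.ne' (q - 1),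
        mul_assoc, div_mul_cancel₀ _ hs.1.ne']
    refine le_trans (le_of_eq ?_) (mul_le_mul_right hweak (ENNReal.ofReal (q * s ^ (q - 1 - 1))))
    rw [← mul_assoc, ← hpow, ← ENNReal.tsum_mul_left, tsum_subtype (t.S x) fun y => σ y *
        (Iic (r y)).indicator (fun s : ℝ => ENNReal.ofReal (q * s ^ (q - 1))) s,
      tsum_subtype {y | y ∈ t.S x ∧ s ≤ r y} fun y => ENNReal.ofReal (q * s ^ (q - 1)) * σ y]
    refine tsum_congr fun y => ?_
    by_cases h1 : y ∈ t.S x <;> by_cases h2 : s ≤ r y <;> simp [h1, h2, mul_comm]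
  have hlayer : t.sigmaSum π p ν x = ∑' y : t.S x, ∫⁻ s in Ioc (0 : ℝ) 1, σ y.1 *
      (Iic (r y.1)).indicator (fun s => ENNReal.ofReal (q * s ^ (q - 1))) s := by
    unfold sigmaSum
    refine tsum_congr fun y => ?_
    rw [lintegral_const_mul _ (hmeas y.1),
      ← ofReal_rpow_eq_setLIntegral hq0 (hr0 y.1) (hr1 y.1), ← hrν y.1, ← hq_def,
      ENNReal.mul_rpow_of_nonneg _ _ hq0.le, mul_assoc, mul_comm]
  rw [hlayer, ← lintegral_tsum fun y : t.S x => ((hmeas y.1).const_mul (σ y.1)).aemeasurable]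
  refine (setLIntegral_mono' measurableSet_Ioc hlevel).trans_eq ?_
  rw [lintegral_mul_const _ (by fun_prop),
    setLIntegral_Ioc_mul_rpow (by linarith) zero_le_one q hq0.le, Real.one_rpow, mul_one, hqp]

end PTTree

/-- monotonicity of the testing condition: if `I*σ_μ ≤ I*μ` on `T`, then for
every Borel `λ : T̄ → [0,1]` one has `I*σ_{λμ} ≤ p · I*(λμ)` on `T`. (Here
`σ_μ(x) = (I*μ(x))^{p'} π(x)^{1-p'}` and `I*σ_μ(x) = Σ_{y ∈ S(x)} σ_μ(y)`.) -/
theorem tree_testing_monotone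
    (t : PTTree) (π : t.V → ℝ) (hπ : ∀ x : t.V, 0 < π x) (p : ℝ) (hp : 1 < p)
    (μ : @Measure t.Tbar t.borelT) (hμ : IsFiniteMeasure μ)
    (lam : t.Tbar → ℝ)
    (hlam_meas : @Measurable t.Tbar ℝ t.borelT Real.measurableSpace lam)
    (hlam0 : ∀ ζ : t.Tbar, 0 ≤ lam ζ) (hlam1 : ∀ ζ : t.Tbar, lam ζ ≤ 1)
    (h : ∀ x : t.V, t.sigmaSum π p μ x ≤ t.Istar μ x) :
    ∀ x : t.V,
      t.sigmaSum π p (μ.withDensity fun ζ => ENNReal.ofReal (lam ζ)) x ≤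
        ENNReal.ofReal p *
          t.Istar (μ.withDensity fun ζ => ENNReal.ofReal (lam ζ)) x := by
  exact t.sigmaSum_le_of_Istar_le π hp μ _ (fun y => @measure_ne_top _ t.borelT μ hμ _)
    (t.Istar_withDensity_le μ fun ζ => ENNReal.ofReal_le_one.2 (hlam1 ζ)) h
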